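/- Fix real parameters a > 0 and b ∈ (0,1), and let E : ℝ → ℝ be given by E(s) = exp(−1/s) for s > 0 and E(s) = 0 for s ≤ 0. Consider the vector field F on ℝ³ (coordinates (x, r₁, ε₁)) given by F(x, r₁, ε₁) = ( r₁(a − r₁), r₁(x + b·r₁·(2 − E(ε₁))), −ε₁(x + b·r₁·(2 − E(ε₁))) ). Then for every x ∈ ℝ the point (x, 0, 0) is an equilibrium of F, and the derivative of F at (x, 0, 0) has eigenvalues 0, x, and −x (i.e. its characteristic polynomial is λ(λ − x)(λ + x)); in particular (x,0,0) is a partially hyperbolic saddle for x ≠ 0 and fully non-hyperbolic for x = 0. -/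

import Mathlib

/-- The exponential `exp(−1/s)` extended by `0` to `s ≤ 0`. -/
noncomputable def expE (s : ℝ) : ℝ := if 0 < s then Real.exp (-1 / s) else 0

/-- The desingularized Le Corbeiller system in the blow-up chart `K₁`,
coordinates `(x, r₁, ε₁)`. -/
noncomputable def corbK1Field (a b : ℝ) (p : ℝ × ℝ × ℝ) : ℝ × ℝ × ℝ :=
  (p.2.1 * (a - p.2.1),
   p.2.1 * (p.1 + b * p.2.1 * (2 - expE p.2.2)),
   -p.2.2 * (p.1 + b * p.2.1 * (2 - expE p.2.2)))

theorem expE_eq_expNegInvGlue : expE = expNegInvGlue := by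
  funext s
  by_cases h : 0 < s
  · simp [expE, expNegInvGlue, h, not_le.mpr h, neg_div]
  · simp [expE, expNegInvGlue, h, not_lt.mp h]

theorem differentiable_expE : Differentiable ℝ expE := by
  rw [expE_eq_expNegInvGlue]
  exact (expNegInvGlue.contDiff (n := 1)).differentiable one_ne_zero

/-- The coordinate isomorphism `ℝ × ℝ × ℝ ≃ ℝ³`. -/
noncomputable def tripleEquivFin : (ℝ × ℝ × ℝ) ≃ₗ[ℝ] (Fin 3 → ℝ) where
  toFun p := ![p.1, p.2.1, p.2.2]
  invFun v := (v 0, v 1, v 2)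
  map_add' p q := by ext i; fin_cases i <;> simp
  map_smul' c p := by ext i; fin_cases i <;> simp
  left_inv p := by simp
  right_inv v := by ext i; fin_cases i <;> simp

/-- The linearization of the chart-`K₁` system at `(x, 0, 0)`, as a matrix. -/
def corbK1Jacobian (a x : ℝ) : Matrix (Fin 3) (Fin 3) ℝ := !![0, a, 0; 0, x, 0; 0, 0, -x]

theorem charpoly_corbK1Jacobian (a x : ℝ) :
    (corbK1Jacobian a x).charpoly =
      Polynomial.X * (Polynomial.X - Polynomial.C x) * (Polynomial.X + Polynomial.C x) := by
  simp [corbK1Jacobian, Matrix.charpoly, Matrix.charmatrix, Matrix.det_fin_three]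

theorem fderiv_corbK1Field_apply (a b x : ℝ) (v : ℝ × ℝ × ℝ) :
    fderiv ℝ (corbK1Field a b) (x, 0, 0) v = (a * v.2.1, x * v.2.1, -x * v.2.2) := by
  have hr : HasFDerivAt (fun p : ℝ × ℝ × ℝ => p.2.1) _ (x, 0, 0) :=
    (hasFDerivAt_snd (𝕜 := ℝ)).fst
  have hε : HasFDerivAt (fun p : ℝ × ℝ × ℝ => p.2.2) _ (x, 0, 0) :=
    (hasFDerivAt_snd (𝕜 := ℝ)).snd
  have hg : DifferentiableAt ℝ
      (fun p : ℝ × ℝ × ℝ => p.1 + b * p.2.1 * (2 - expE p.2.2)) (x, 0, 0) := by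
    have hE : DifferentiableAt ℝ (fun p : ℝ × ℝ × ℝ => expE p.2.2) (x, 0, 0) :=
      (differentiable_expE _).comp _ hε.differentiableAt
    fun_prop
  have hF : HasFDerivAt (corbK1Field a b) _ (x, 0, 0) :=
    (hr.mul (hr.const_sub a)).prodMk
      ((hr.mul hg.hasFDerivAt).prodMk (hε.neg.mul hg.hasFDerivAt))
  rw [hF.fderiv]
  simp

/-- Every point `(x,0,0)` is an equilibrium of the chart-`K₁` system, and the linearization
there has characteristic polynomial `λ(λ − x)(λ + x)`, i.e. eigenvalues `0, x, −x`. -/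
theorem corbK1_line_of_saddles (a b : ℝ) (ha : 0 < a) (hb : b ∈ Set.Ioo (0 : ℝ) 1)
    (x : ℝ) :
    corbK1Field a b (x, 0, 0) = 0 ∧
    LinearMap.charpoly ((fderiv ℝ (corbK1Field a b) (x, 0, 0)).toLinearMap) =
      Polynomial.X * (Polynomial.X - Polynomial.C x) * (Polynomial.X + Polynomial.C x) := by
  refine ⟨by simp [corbK1Field], ?_⟩
  have hconj : tripleEquivFin.conj (fderiv ℝ (corbK1Field a b) (x, 0, 0)).toLinearMap =
      Matrix.toLin' (corbK1Jacobian a x) := by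
    refine LinearMap.ext fun v => ?_
    rw [LinearEquiv.conj_apply_apply, ContinuousLinearMap.coe_coe, fderiv_corbK1Field_apply]
    ext i
    fin_cases i <;>
      simp [tripleEquivFin, corbK1Jacobian, Matrix.mulVec, dotProduct, Fin.sum_univ_three]
  rw [← LinearEquiv.charpoly_conj tripleEquivFin, hconj, Matrix.charpoly_toLin',
    charpoly_corbK1Jacobian]
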